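/- Lemma 4 (conditional interference bound). Under the PIR-with-private-side-information setup, let 𝒫_1, 𝒫_2 ⊆ {1,…,K}\S with |𝒫_1| = |𝒫_2| = P and 𝒫_1 ∩ 𝒫_2 = ∅, and let A_1 = A_1^{S,𝒫_1}. Then H(A_2^{S,𝒫_2}, A_3^{S,𝒫_2}, …, A_N^{S,𝒫_2} | W_{𝒫_1}, Q, W_S) ≤ (N−1)·[N·H(A_1 | Q, W_S) − P·L]. -/

import Mathlib

open scoped BigOperators

/-- Probability that random variable `X` takes the value `x`, under the
probability mass function `p` on the finite sample space `Ω`. -/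
noncomputable def pr {Ω : Type} [Fintype Ω] (p : Ω → ℝ) {α : Type} [DecidableEq α]
    (X : Ω → α) (x : α) : ℝ :=
  ∑ ω ∈ Finset.univ.filter (fun ω => X ω = x), p ω

/-- Shannon entropy of `X` in base `b` (with the convention `0 * log 0 = 0`). -/
noncomputable def ent {Ω : Type} [Fintype Ω] (b : ℝ) (p : Ω → ℝ) {α : Type} [Fintype α]
    [DecidableEq α] (X : Ω → α) : ℝ :=
  -∑ x : α, pr p X x * Real.logb b (pr p X x)

/-- Conditional entropy `H(X ∣ Y) = H(X, Y) - H(Y)`, in base `b`. -/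
noncomputable def condEnt {Ω : Type} [Fintype Ω] (b : ℝ) (p : Ω → ℝ) {α β : Type} [Fintype α]
    [DecidableEq α] [Fintype β] [DecidableEq β] (X : Ω → α) (Y : Ω → β) : ℝ :=
  ent b p (fun ω => (X ω, Y ω)) - ent b p Y

/-- `X` is a deterministic function of `Y`. -/
def detFn {Ω α β : Type} (X : Ω → α) (Y : Ω → β) : Prop :=
  ∃ f : β → α, ∀ ω, X ω = f (Y ω)

/-- Admissible demand sets: subsets of `{1,…,K} \ S` of size `P`
(indices are `0`-based, and `S = {1,…,M}` corresponds to indices `< M`). -/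
def demands (K M P : ℕ) : Finset (Finset (Fin K)) :=
  Finset.univ.filter (fun T => T.card = P ∧ ∀ i ∈ T, M ≤ i.val)

section Entropy

variable {Ω : Type} [Fintype Ω] {p : Ω → ℝ} {b : ℝ}
  {α β γ : Type} [Fintype α] [DecidableEq α] [Fintype β] [DecidableEq β]
  [Fintype γ] [DecidableEq γ]

theorem sum_mul_comp_eq_sum_pr_mul (X : Ω → α) (g : α → ℝ) :
    ∑ ω, p ω * g (X ω) = ∑ x, pr p X x * g x := by
  simp only [pr, Finset.sum_mul]
  rw [← Finset.sum_fiberwise (s := Finset.univ) (g := X) (f := fun ω => p ω * g (X ω))]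
  refine Finset.sum_congr rfl fun x _ => Finset.sum_congr rfl fun ω hω => ?_
  rw [(Finset.mem_filter.1 hω).2]

theorem ent_eq_neg_sum (X : Ω → α) :
    ent b p X = -∑ ω, p ω * Real.logb b (pr p X (X ω)) := by
  rw [ent, sum_mul_comp_eq_sum_pr_mul X fun x => Real.logb b (pr p X x)]

omit [Fintype α] in
theorem pr_nonneg (hp : ∀ ω, 0 ≤ p ω) (X : Ω → α) (x : α) : 0 ≤ pr p X x :=
  Finset.sum_nonneg fun ω _ => hp ω

omit [Fintype α] in
theorem le_pr_self (hp : ∀ ω, 0 ≤ p ω) (X : Ω → α) (ω : Ω) : p ω ≤ pr p X (X ω) :=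
  Finset.single_le_sum (f := p) (fun ω _ => hp ω) (by simp)

omit [Fintype α] [Fintype β] in
theorem pr_le_pr_of_detFn (hp : ∀ ω, 0 ≤ p ω) {X : Ω → α} {Y : Ω → β} (h : detFn X Y)
    (ω : Ω) : pr p Y (Y ω) ≤ pr p X (X ω) := by
  obtain ⟨f, hf⟩ := h
  refine Finset.sum_le_sum_of_subset_of_nonneg (fun ω' hω' => ?_) fun ω _ _ => hp ω
  have hY : Y ω' = Y ω := by simpa using hω'
  simp [hf, hY]

theorem ent_le_of_detFn (hp : ∀ ω, 0 ≤ p ω) (hb : 1 < b) {X : Ω → α} {Y : Ω → β}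
    (h : detFn X Y) : ent b p X ≤ ent b p Y := by
  rw [ent_eq_neg_sum, ent_eq_neg_sum, neg_le_neg_iff]
  refine Finset.sum_le_sum fun ω _ => ?_
  rcases (hp ω).eq_or_lt with h0 | h0
  · simp [← h0]
  · exact mul_le_mul_of_nonneg_left (Real.logb_le_logb_of_le hb
      (h0.trans_le (le_pr_self hp Y ω)) (pr_le_pr_of_detFn hp h ω)) h0.le

theorem ent_congr_of_detFn (hp : ∀ ω, 0 ≤ p ω) (hb : 1 < b) {X : Ω → α} {Y : Ω → β}
    (h : detFn X Y) (h' : detFn Y X) : ent b p X = ent b p Y :=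
  le_antisymm (ent_le_of_detFn hp hb h) (ent_le_of_detFn hp hb h')

theorem condEnt_le_of_detFn (hp : ∀ ω, 0 ≤ p ω) (hb : 1 < b) {X : Ω → α} {Y : Ω → β}
    {Z : Ω → γ} (h : detFn X fun ω => (Y ω, Z ω)) : condEnt b p X Z ≤ condEnt b p Y Z := by
  obtain ⟨f, hf⟩ := h
  exact sub_le_sub_right (ent_le_of_detFn hp hb ⟨fun y => (f y, y.2), fun ω => by simp [hf]⟩) _

theorem sum_mul_logb_nonneg (hp : ∀ ω, 0 ≤ p ω) (hp1 : ∑ ω, p ω = 1) (hb : 1 < b)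
    {r : Ω → ℝ} (hr : ∀ ω, 0 < p ω → 0 < r ω) (hsum : ∑ ω, p ω * (r ω)⁻¹ ≤ 1) :
    0 ≤ ∑ ω, p ω * Real.logb b (r ω) := by
  have hlog : 0 ≤ ∑ ω, p ω * Real.log (r ω) := by
    have : ∑ ω, p ω * (1 - (r ω)⁻¹) ≤ ∑ ω, p ω * Real.log (r ω) := by
      refine Finset.sum_le_sum fun ω _ => ?_
      rcases (hp ω).eq_or_lt with h0 | h0
      · simp [← h0]
      · exact mul_le_mul_of_nonneg_left (Real.one_sub_inv_le_log_of_pos (hr ω h0)) h0.le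
    simp only [mul_sub, mul_one, Finset.sum_sub_distrib, hp1] at this
    linarith
  simp only [Real.logb, ← mul_div_assoc, ← Finset.sum_div]
  exact div_nonneg hlog (Real.log_pos hb).le

theorem ent_le_logb_card (hp : ∀ ω, 0 ≤ p ω) (hp1 : ∑ ω, p ω = 1) (hb : 1 < b)
    (X : Ω → α) : ent b p X ≤ Real.logb b (Fintype.card α) := by
  have hcard : ∀ ω : Ω, 0 < (Fintype.card α : ℝ) := fun ω =>
    Nat.cast_pos.2 (Fintype.card_pos_iff.2 ⟨X ω⟩)
  have key : 0 ≤ ∑ ω, p ω * Real.logb b (Fintype.card α * pr p X (X ω)) := by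
    refine sum_mul_logb_nonneg hp hp1 hb
      (fun ω h => mul_pos (hcard ω) (h.trans_le (le_pr_self hp X ω))) ?_
    rw [sum_mul_comp_eq_sum_pr_mul X fun x => ((Fintype.card α : ℝ) * pr p X x)⁻¹]
    calc ∑ x, pr p X x * ((Fintype.card α : ℝ) * pr p X x)⁻¹
        ≤ ∑ _x : α, (Fintype.card α : ℝ)⁻¹ := by
          refine Finset.sum_le_sum fun x _ => ?_
          rw [mul_inv, mul_left_comm]
          exact mul_le_of_le_one_right (by positivity) mul_inv_le_one
      _ ≤ 1 := by simpa using mul_inv_le_one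
  have hsplit : ∑ ω, p ω * Real.logb b (Fintype.card α * pr p X (X ω))
      = Real.logb b (Fintype.card α) - ent b p X := by
    rw [ent_eq_neg_sum, sub_neg_eq_add]
    rw [← one_mul (Real.logb b (Fintype.card α)), ← hp1, Finset.sum_mul, ← Finset.sum_add_distrib]
    refine Finset.sum_congr rfl fun ω _ => ?_
    rcases (hp ω).eq_or_lt with h0 | h0
    · simp [← h0]
    · rw [Real.logb_mul (hcard ω).ne' (h0.trans_le (le_pr_self hp X ω)).ne', mul_add]
  linarith

omit [Fintype γ] in
theorem sum_pr_pair (X : Ω → α) (Z : Ω → γ) (z : γ) :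
    ∑ x, pr p (fun ω => (X ω, Z ω)) (x, z) = pr p Z z := by
  simp only [pr, Prod.mk.injEq, Finset.sum_filter]
  rw [Finset.sum_comm]
  refine Finset.sum_congr rfl fun ω _ => ?_
  simp [ite_and]

theorem sum_pr (X : Ω → α) : ∑ x, pr p X x = ∑ ω, p ω := by
  simpa using (sum_mul_comp_eq_sum_pr_mul (p := p) X fun _ => 1).symm

theorem ent_submodular (hp : ∀ ω, 0 ≤ p ω) (hp1 : ∑ ω, p ω = 1) (hb : 1 < b)
    (X : Ω → α) (Y : Ω → β) (Z : Ω → γ) :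
    ent b p (fun ω => ((X ω, Y ω), Z ω)) + ent b p Z
      ≤ ent b p (fun ω => (X ω, Z ω)) + ent b p (fun ω => (Y ω, Z ω)) := by
  set U := fun ω => ((X ω, Y ω), Z ω) with hU
  set V := fun ω => (X ω, Z ω) with hV
  set T := fun ω => (Y ω, Z ω) with hT
  have key : 0 ≤ ∑ ω, p ω * Real.logb b
      (pr p U (U ω) * pr p Z (Z ω) / (pr p V (V ω) * pr p T (T ω))) := by
    refine sum_mul_logb_nonneg hp hp1 hb (fun ω h => ?_) ?_
    · have hpos : ∀ {δ : Type} [DecidableEq δ] (R : Ω → δ), 0 < pr p R (R ω) := fun R =>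
        h.trans_le (Finset.single_le_sum (f := p) (fun ω _ => hp ω) (by simp))
      exact div_pos (mul_pos (hpos U) (hpos Z)) (mul_pos (hpos V) (hpos T))
    · rw [sum_mul_comp_eq_sum_pr_mul U fun u : (α × β) × γ =>
        (pr p U u * pr p Z u.2 / (pr p V (u.1.1, u.2) * pr p T (u.1.2, u.2)))⁻¹]
      calc _ ≤ ∑ u : (α × β) × γ,
            (pr p Z u.2)⁻¹ * (pr p V (u.1.1, u.2) * pr p T (u.1.2, u.2)) := by
            refine Finset.sum_le_sum fun u _ => ?_
            have h0 : 0 ≤ (pr p Z u.2)⁻¹ * (pr p V (u.1.1, u.2) * pr p T (u.1.2, u.2)) :=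
              mul_nonneg (inv_nonneg.2 (pr_nonneg hp _ _))
                (mul_nonneg (pr_nonneg hp _ _) (pr_nonneg hp _ _))
            have : pr p U u *
                (pr p U u * pr p Z u.2 / (pr p V (u.1.1, u.2) * pr p T (u.1.2, u.2)))⁻¹
                = (pr p Z u.2)⁻¹ * (pr p V (u.1.1, u.2) * pr p T (u.1.2, u.2)) *
                  (pr p U u * (pr p U u)⁻¹) := by
              rw [inv_div, div_eq_mul_inv, mul_inv]; ring
            rw [this]
            exact mul_le_of_le_one_right h0 mul_inv_le_one
        _ = ∑ z, (pr p Z z)⁻¹ * (pr p Z z * pr p Z z) := by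
            rw [Fintype.sum_prod_type_right]
            refine Finset.sum_congr rfl fun z _ => ?_
            simp only [Fintype.sum_prod_type, ← Finset.mul_sum, ← Finset.sum_mul]
            rw [sum_pr_pair X Z z, sum_pr_pair Y Z z]
        _ ≤ ∑ z, pr p Z z := by
            refine Finset.sum_le_sum fun z _ => ?_
            rw [← mul_assoc]
            exact mul_le_of_le_one_left (pr_nonneg hp _ _) inv_mul_le_one
        _ = 1 := by rw [sum_pr, hp1]
  have hsplit : ∑ ω, p ω * Real.logb b
      (pr p U (U ω) * pr p Z (Z ω) / (pr p V (V ω) * pr p T (T ω)))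
      = ent b p V + ent b p T - (ent b p U + ent b p Z) := by
    simp only [ent_eq_neg_sum]
    have : ∀ a b c d : ℝ, -a + -b - (-c + -d) = (c + d) - (a + b) := by intros; ring
    rw [this]
    simp only [← Finset.sum_add_distrib, ← Finset.sum_sub_distrib]
    refine Finset.sum_congr rfl fun ω _ => ?_
    rcases (hp ω).eq_or_lt with h0 | h0
    · simp [← h0]
    · have hU0 := (h0.trans_le (le_pr_self hp U ω)).ne'
      have hV0 := (h0.trans_le (le_pr_self hp V ω)).ne'
      have hT0 := (h0.trans_le (le_pr_self hp T ω)).ne'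
      have hZ0 := (h0.trans_le (le_pr_self hp Z ω)).ne'
      rw [Real.logb_div (mul_ne_zero hU0 hZ0) (mul_ne_zero hV0 hT0),
        Real.logb_mul hU0 hZ0, Real.logb_mul hV0 hT0]
      ring
  linarith

theorem condEnt_prodMk_le (hp : ∀ ω, 0 ≤ p ω) (hp1 : ∑ ω, p ω = 1) (hb : 1 < b)
    (X : Ω → α) (Y : Ω → β) (Z : Ω → γ) :
    condEnt b p (fun ω => (X ω, Y ω)) Z ≤ condEnt b p X Z + condEnt b p Y Z := by
  have := ent_submodular hp hp1 hb X Y Z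
  simp only [condEnt]
  linarith

theorem ent_nonneg (hp : ∀ ω, 0 ≤ p ω) (hp1 : ∑ ω, p ω = 1) (hb : 1 < b) (X : Ω → α) :
    0 ≤ ent b p X := by
  have h : ent b p (fun _ : Ω => ()) = 0 := by simp [ent, pr, hp1]
  exact h ▸ ent_le_of_detFn hp hb ⟨fun _ => (), fun _ => rfl⟩

theorem ent_prodMk_le (hp : ∀ ω, 0 ≤ p ω) (hp1 : ∑ ω, p ω = 1) (hb : 1 < b)
    (X : Ω → α) (Y : Ω → β) : ent b p (fun ω => (X ω, Y ω)) ≤ ent b p X + ent b p Y := by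
  have h := ent_submodular hp hp1 hb X Y fun _ => ()
  have h0 := ent_nonneg hp hp1 hb fun _ : Ω => ()
  have h1 : ent b p (fun ω => (X ω, Y ω)) ≤ ent b p (fun ω => ((X ω, Y ω), ())) :=
    ent_le_of_detFn hp hb ⟨Prod.fst, fun _ => rfl⟩
  have h2 : ent b p (fun ω => (X ω, ())) ≤ ent b p X :=
    ent_le_of_detFn hp hb ⟨fun x => (x, ()), fun _ => rfl⟩
  have h3 : ent b p (fun ω => (Y ω, ())) ≤ ent b p Y :=
    ent_le_of_detFn hp hb ⟨fun x => (x, ()), fun _ => rfl⟩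
  linarith

theorem ent_le_add_of_detFn (hp : ∀ ω, 0 ≤ p ω) (hp1 : ∑ ω, p ω = 1) (hb : 1 < b)
    {X : Ω → α} {Y : Ω → β} {Z : Ω → γ} (h : detFn X fun ω => (Y ω, Z ω)) :
    ent b p X ≤ ent b p Y + ent b p Z :=
  (ent_le_of_detFn hp hb h).trans (ent_prodMk_le hp hp1 hb Y Z)

theorem condEnt_finset_pi_le_sum (hp : ∀ ω, 0 ≤ p ω) (hp1 : ∑ ω, p ω = 1) (hb : 1 < b)
    {ι : Type} [DecidableEq ι] (X : ι → Ω → α) (Z : Ω → γ) (s : Finset ι) :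
    condEnt b p (fun ω (i : s) => X i ω) Z ≤ ∑ i ∈ s, condEnt b p (X i) Z := by
  induction s using Finset.induction_on with
  | empty =>
    have : ent b p (fun ω => ((fun i : (∅ : Finset ι) => X i ω), Z ω)) ≤ ent b p Z :=
      ent_le_of_detFn hp hb ⟨fun z => (fun i => absurd i.2 (Finset.notMem_empty _), z),
        fun ω => Prod.ext (funext fun i => absurd i.2 (Finset.notMem_empty _)) rfl⟩
    simpa [condEnt] using this
  | insert a s ha ih =>
    rw [Finset.sum_insert ha]
    refine le_trans ?_ ((condEnt_prodMk_le hp hp1 hb (X a) (fun ω (i : s) => X i ω) Z).trans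
      (by gcongr))
    refine condEnt_le_of_detFn hp hb ⟨fun y i => if h : i.1 = a then y.1.1 else
      y.1.2 ⟨i.1, (Finset.mem_insert.1 i.2).resolve_left h⟩, fun ω => funext fun i => ?_⟩
    by_cases h : i.1 = a <;> simp [h]

theorem condEnt_pi_le_sum (hp : ∀ ω, 0 ≤ p ω) (hp1 : ∑ ω, p ω = 1) (hb : 1 < b)
    {ι : Type} [Fintype ι] [DecidableEq ι] (X : ι → Ω → α) (Z : Ω → γ) :
    condEnt b p (fun ω i => X i ω) Z ≤ ∑ i, condEnt b p (X i) Z :=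
  (condEnt_le_of_detFn (Y := fun ω (i : (Finset.univ : Finset ι)) => X i ω) hp hb
    ⟨fun y i => y.1 ⟨i, Finset.mem_univ i⟩, fun _ => rfl⟩).trans
    (condEnt_finset_pi_le_sum hp hp1 hb X Z Finset.univ)

theorem condEnt_chain (hp : ∀ ω, 0 ≤ p ω) (hb : 1 < b)
    (X : Ω → α) (Y : Ω → β) (Z : Ω → γ) :
    condEnt b p Y Z + condEnt b p X (fun ω => (Y ω, Z ω))
      = condEnt b p (fun ω => (X ω, Y ω)) Z := by
  have h : ent b p (fun ω => (X ω, Y ω, Z ω)) = ent b p (fun ω => ((X ω, Y ω), Z ω)) :=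
    ent_congr_of_detFn hp hb ⟨fun u => (u.1.1, u.1.2, u.2), fun _ => rfl⟩
      ⟨fun u => ((u.1, u.2.1), u.2.2), fun _ => rfl⟩
  simp only [condEnt, h]
  ring

end Entropy

section Files

variable {F : Type} [Field F] [Fintype F] [DecidableEq F] {Ω : Type} [Fintype Ω] {p : Ω → ℝ}
  {K L : ℕ} {W : Fin K → Ω → Fin L → F} {γ : Type} [Fintype γ] [DecidableEq γ] {Q : Ω → γ}

theorem ent_files_le (hp : ∀ ω, 0 ≤ p ω) (hp1 : ∑ ω, p ω = 1) (T : Finset (Fin K)) :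
    ent (Fintype.card F) p (fun ω (i : T) => W i ω) ≤ (T.card : ℝ) * L := by
  have hb : (1 : ℝ) < Fintype.card F := Nat.one_lt_cast.2 Fintype.one_lt_card
  refine (ent_le_logb_card hp hp1 hb _).trans_eq ?_
  simp only [Fintype.card_pi, Finset.prod_const, Finset.card_univ, Fintype.card_fin,
    Fintype.card_coe, Nat.cast_pow, ← pow_mul]
  rw [Real.logb_pow, Real.logb_self_eq_one hb]
  push_cast
  ring

theorem ent_files_queries (hp : ∀ ω, 0 ≤ p ω) (hp1 : ∑ ω, p ω = 1)
    (hUnif : ∀ (w : Fin K → Fin L → F) (q : γ),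
      pr p (fun ω => ((fun i => W i ω), Q ω)) (w, q)
        = ((Fintype.card F : ℝ) ^ (K * L))⁻¹ * pr p Q q) :
    ent (Fintype.card F) p (fun ω => ((fun i => W i ω), Q ω))
      = (K : ℝ) * L + ent (Fintype.card F) p Q := by
  have hb : (1 : ℝ) < Fintype.card F := Nat.one_lt_cast.2 Fintype.one_lt_card
  rw [ent_eq_neg_sum, ent_eq_neg_sum, ← one_mul ((K : ℝ) * L), ← hp1, Finset.sum_mul,
    ← sub_eq_add_neg, ← Finset.sum_sub_distrib, ← Finset.sum_neg_distrib]
  refine Finset.sum_congr rfl fun ω _ => ?_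
  rcases (hp ω).eq_or_lt with h0 | h0
  · simp [← h0]
  · rw [hUnif, Real.logb_mul (by positivity) (h0.trans_le (le_pr_self hp Q ω)).ne',
      Real.logb_inv, Real.logb_pow, Real.logb_self_eq_one hb]
    push_cast
    ring

theorem card_mul_le_condEnt_files (hp : ∀ ω, 0 ≤ p ω) (hp1 : ∑ ω, p ω = 1)
    (hUnif : ∀ (w : Fin K → Fin L → F) (q : γ),
      pr p (fun ω => ((fun i => W i ω), Q ω)) (w, q)
        = ((Fintype.card F : ℝ) ^ (K * L))⁻¹ * pr p Q q)
    {D S : Finset (Fin K)} (hDS : Disjoint D S) :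
    (D.card : ℝ) * L ≤ condEnt (Fintype.card F) p (fun ω (i : D) => W i ω)
      (fun ω => (Q ω, fun i : S => W i ω)) := by
  have hb : (1 : ℝ) < Fintype.card F := Nat.one_lt_cast.2 Fintype.one_lt_card
  obtain ⟨E, hE⟩ : ∃ E, E = (D ∪ S)ᶜ := ⟨_, rfl⟩
  have hall := ent_files_queries hp hp1 hUnif
  have hsub : ent (Fintype.card F) p (fun ω => ((fun i => W i ω), Q ω))
      ≤ ent (Fintype.card F) p (fun ω => ((fun i : D => W i ω), Q ω, fun i : S => W i ω))
        + ent (Fintype.card F) p (fun ω (i : E) => W i ω) := by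
    refine ent_le_add_of_detFn hp hp1 hb ⟨fun u => (fun i =>
      if hD : i ∈ D then u.1.1 ⟨i, hD⟩ else if hS : i ∈ S then u.1.2.2 ⟨i, hS⟩
      else u.2 ⟨i, by simp [hE, hD, hS]⟩, u.1.2.1), fun ω => ?_⟩
    refine Prod.ext (funext fun i => ?_) rfl
    by_cases hD : i ∈ D <;> by_cases hS : i ∈ S <;> simp [hD, hS]
  have hrest := ent_files_le (W := W) hp hp1 E
  have hS := (ent_prodMk_le hp hp1 hb Q fun ω (i : S) => W i ω).trans
    (add_le_add_right (ent_files_le hp hp1 S) _)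
  have hcard : (K : ℝ) = D.card + S.card + E.card := by
    have h := Finset.card_add_card_compl (D ∪ S)
    rw [← hE, Finset.card_union_of_disjoint hDS, Fintype.card_fin] at h
    exact_mod_cast h.symm
  rw [hcard] at hall
  simp only [condEnt]
  linarith

end Files

/-- Lemma 4 of the paper (conditional interference bound): for disjoint demand
sets `𝒫₁, 𝒫₂ ⊆ {1,…,K} \ S` of size `P`,
`H(A₂^{S,𝒫₂},…,A_N^{S,𝒫₂} ∣ W_{𝒫₁}, Q, W_S) ≤ (N-1)·[N·H(A₁^{S,𝒫₁} ∣ Q, W_S) - P·L]`. -/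
theorem lemma4_conditional_interference_bound
    (F : Type) [Field F] [Fintype F] [DecidableEq F]
    (QT AT : Type) [Fintype QT] [DecidableEq QT] [Fintype AT] [DecidableEq AT]
    (Ω : Type) [Fintype Ω]
    (p : Ω → ℝ) (hp0 : ∀ ω, 0 ≤ p ω) (hp1 : ∑ ω, p ω = 1)
    (N K L M P : ℕ) (hN : 0 < N)
    (W : Fin K → Ω → (Fin L → F))
    (Qu : ↥(demands K M P) → Fin N → Ω → QT)
    (A : ↥(demands K M P) → Fin N → Ω → AT)
    (Qall : Ω → (↥(demands K M P) → Fin N → QT))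
    (hQall : Qall = fun ω d n => Qu d n ω)
    (S : Finset (Fin K)) (hS : S = Finset.univ.filter (fun i => i.val < M))
    -- the files are i.i.d. uniform on `F^L` and independent of all the queries
    (hUnif : ∀ (w : Fin K → Fin L → F) (q : ↥(demands K M P) → Fin N → QT),
      pr p (fun ω => ((fun i => W i ω), Qall ω)) (w, q)
        = ((Fintype.card F : ℝ) ^ (K * L))⁻¹ * pr p Qall q)
    -- each answer is a deterministic function of the library and the received query
    (hAns : ∀ (d : ↥(demands K M P)) (n : Fin N),
      detFn (A d n) (fun ω => ((fun i => W i ω), Qu d n ω)))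
    -- decodability
    (hDec : ∀ d : ↥(demands K M P),
      detFn (fun ω => (fun i : ↥(d : Finset (Fin K)) => W i.val ω))
        (fun ω => ((fun n => A d n ω), Qall ω, (fun i : ↥S => W i.val ω))))
    -- privacy/symmetry (i)
    (hSym : ∀ (n : Fin N) (d d' : ↥(demands K M P)) (T : Finset (Fin K)),
      condEnt (Fintype.card F) p (A d n)
          (fun ω => (Qall ω, (fun i : ↥T => W i.val ω)))
        = condEnt (Fintype.card F) p (A d' ⟨0, hN⟩)
          (fun ω => (Qall ω, (fun i : ↥T => W i.val ω))))
    -- privacy/symmetry (ii)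
    (hMix : ∀ (n : Fin N) (d d' : ↥(demands K M P)),
      detFn (fun ω => (fun i : ↥(d : Finset (Fin K)) => W i.val ω))
        (fun ω => ((fun m : Fin N => if m = n then A d' n ω else A d m ω),
          Qall ω, (fun i : ↥S => W i.val ω))))
    (d1 d2 : ↥(demands K M P))
    (hDisj : Disjoint (d1 : Finset (Fin K)) (d2 : Finset (Fin K))) :
    condEnt (Fintype.card F) p
        (fun ω => (fun m : {m : Fin N // m ≠ ⟨0, hN⟩} => A d2 m.val ω))
        (fun ω => ((fun i : ↥(d1 : Finset (Fin K)) => W i.val ω), Qall ω,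
          (fun i : ↥S => W i.val ω)))
      ≤ ((N : ℝ) - 1) *
          ((N : ℝ) * condEnt (Fintype.card F) p (A d1 ⟨0, hN⟩)
              (fun ω => (Qall ω, (fun i : ↥S => W i.val ω)))
            - (P : ℝ) * L) := by
  have hb : (1 : ℝ) < Fintype.card F := Nat.one_lt_cast.2 Fintype.one_lt_card
  obtain ⟨hcard, hge⟩ := (Finset.mem_filter.1 d1.2).2
  have hdS : Disjoint (d1 : Finset (Fin K)) S := by
    rw [Finset.disjoint_left]
    intro i hi hiS
    have := hge i hi
    simp only [hS, Finset.mem_filter, Finset.mem_univ, true_and] at hiS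
    omega
  have hfiles := card_mul_le_condEnt_files hp0 hp1 hUnif hdS
  rw [hcard] at hfiles
  have hserver : ∀ n : Fin N, condEnt (Fintype.card F) p (A d2 n)
      (fun ω => ((fun i : ↥(d1 : Finset (Fin K)) => W i.val ω), Qall ω,
        (fun i : ↥S => W i.val ω)))
      ≤ (N : ℝ) * condEnt (Fintype.card F) p (A d1 ⟨0, hN⟩)
          (fun ω => (Qall ω, (fun i : ↥S => W i.val ω))) - (P : ℝ) * L := by
    intro n
    have hchain := condEnt_chain hp0 hb (A d2 n)
      (fun ω (i : ↥(d1 : Finset (Fin K))) => W i.val ω)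
      (fun ω => (Qall ω, (fun i : ↥S => W i.val ω)))
    have hdet : condEnt (Fintype.card F) p
        (fun ω => (A d2 n ω, fun i : ↥(d1 : Finset (Fin K)) => W i.val ω))
        (fun ω => (Qall ω, (fun i : ↥S => W i.val ω)))
        ≤ condEnt (Fintype.card F) p
          (fun ω m => (if m = n then A d2 n else A d1 m) ω)
          (fun ω => (Qall ω, (fun i : ↥S => W i.val ω))) := by
      obtain ⟨f, hf⟩ := hMix n d1 d2
      refine condEnt_le_of_detFn hp0 hb ⟨fun u => (u.1 n, f u), fun ω => ?_⟩
      simp only [hf ω, ite_apply, if_true]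
    have hsum := condEnt_pi_le_sum hp0 hp1 hb (fun m => if m = n then A d2 n else A d1 m)
      (fun ω => (Qall ω, (fun i : ↥S => W i.val ω)))
    have hterm : ∀ m : Fin N, condEnt (Fintype.card F) p (if m = n then A d2 n else A d1 m)
        (fun ω => (Qall ω, (fun i : ↥S => W i.val ω)))
        = condEnt (Fintype.card F) p (A d1 ⟨0, hN⟩)
          (fun ω => (Qall ω, (fun i : ↥S => W i.val ω))) := by
      intro m
      split_ifs
      · exact hSym n d2 d1 S
      · exact hSym m d1 d1 S
    simp only [hterm, Finset.sum_const, Finset.card_univ, Fintype.card_fin,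
      nsmul_eq_mul] at hsum
    linarith
  refine (condEnt_pi_le_sum hp0 hp1 hb
    (fun m : {m : Fin N // m ≠ ⟨0, hN⟩} => A d2 m.val) _).trans
    ((Finset.sum_le_sum fun m _ => hserver m.val).trans_eq ?_)
  rw [Finset.sum_const, Finset.card_univ, Fintype.card_subtype_compl, Fintype.card_fin,
    Fintype.card_subtype_eq, nsmul_eq_mul, Nat.cast_sub hN, Nat.cast_one]
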